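/- Summation formula for the Izergin determinant (main lemma, second form): let m₁, m₂ ≥ 0 and let ᾱ ∈ ℂ^{m₁}, β̄ ∈ ℂ^{m₂}, γ̄ ∈ ℂ^{m₁+m₂} be tuples such that: the entries of ᾱ are pairwise distinct, the entries of β̄ are pairwise distinct, the entries of γ̄ are pairwise distinct, α_i ≠ γ_k and β_j ≠ γ_k for all indices, α_i ≠ q²β_j for all i,j, and q²β_j ≠ γ_k for all j,k. Then ∑_{I} K_{m₁}(γ̄_I | ᾱ)·K_{m₂}(β̄ | γ̄_{II})·f(γ̄_{II}, γ̄_I) = (−q)^{m₂}·f(β̄, γ̄)·K_{m₁+m₂}(γ̄ | (ᾱ, q²β̄)), where the sum is over all subsets I ⊆ {1,…,m₁+m₂} of size m₁, γ̄_I and γ̄_{II} denote the subtuples of γ̄ indexed by I and its complement (in increasing index order), f(γ̄_{II},γ̄_I) = ∏_{k∈II}∏_{l∈I} f(γ_k,γ_l), f(β̄,γ̄) = ∏_{j}∏_{k} f(β_j,γ_k), and (ᾱ, q²β̄) denotes the concatenated tuple (α₁,…,α_{m₁}, q²β₁,…,q²β_{m₂}). -/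

import Mathlib

open Finset

/-- The function `f(u,v) = (qu - q⁻¹v)/(u - v)`. -/
noncomputable def fF (q u v : ℂ) : ℂ := (q * u - q⁻¹ * v) / (u - v)

/-- The function `g(u,v) = (q - q⁻¹)/(u - v)`. -/
noncomputable def gF (q u v : ℂ) : ℂ := (q - q⁻¹) / (u - v)

/-- The Izergin determinant `K_n(x̄|ȳ)`. -/
noncomputable def Kiz (q : ℂ) {n : ℕ} (x y : Fin n → ℂ) : ℂ :=
  (∏ i : Fin n, ∏ j ∈ Finset.Ioi i, ((x i - x j) * (y j - y i)))⁻¹ *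
    ∑ σ : Equiv.Perm (Fin n), ((Equiv.Perm.sign σ : ℤ) : ℂ) *
      ∏ i : Fin n,
        ((q - q⁻¹) / (x i - y (σ i)) *
          ∏ j ∈ Finset.univ.erase (σ i), (q * x i - q⁻¹ * y j))

/-- The modified Izergin determinant `K^{(l)}_n(x̄|ȳ) = (∏ x_i)·K_n(x̄|ȳ)`. -/
noncomputable def Kl (q : ℂ) {n : ℕ} (x y : Fin n → ℂ) : ℂ := (∏ i, x i) * Kiz q x y

/-- The modified Izergin determinant `K^{(r)}_n(x̄|ȳ) = (∏ y_j)·K_n(x̄|ȳ)`. -/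
noncomputable def Kr (q : ℂ) {n : ℕ} (x y : Fin n → ℂ) : ℂ := (∏ j, y j) * Kiz q x y

/-- The subtuple of `γ` indexed by a finset `I` of cardinality `m`, in increasing
index order. -/
noncomputable def sub {N m : ℕ} (γ : Fin N → ℂ) (I : Finset (Fin N)) (h : I.card = m) :
    Fin m → ℂ :=
  fun k => γ (I.orderIsoOfFin h k : Fin N)

lemma card_compl_of_mem_powersetCard {m₁ m₂ : ℕ}
    (I : {I : Finset (Fin (m₁ + m₂)) // I ∈ Finset.powersetCard m₁ Finset.univ}) :
    I.1ᶜ.card = m₂ := by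
  have h := (Finset.mem_powersetCard.mp I.2).2
  rw [Finset.card_compl, h, Fintype.card_fin]
  omega

/-- The matrix whose determinant is the numerator of the Izergin determinant. -/
noncomputable def izMat (q : ℂ) {n : ℕ} (x y : Fin n → ℂ) : Matrix (Fin n) (Fin n) ℂ :=
  Matrix.of fun j i =>
    (q - q⁻¹) / (x i - y j) * ∏ j' ∈ Finset.univ.erase j, (q * x i - q⁻¹ * y j')

lemma Kiz_eq_det (q : ℂ) {n : ℕ} (x y : Fin n → ℂ) :
    Kiz q x y = (∏ i : Fin n, ∏ j ∈ Finset.Ioi i, ((x i - x j) * (y j - y i)))⁻¹ *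
      (izMat q x y).det := by
  simp [Kiz, izMat, Matrix.det_apply']

lemma prod_erase_zero {M : Type*} [CommMonoid M] {n : ℕ} (F : Fin (n + 1) → M) :
    ∏ j ∈ Finset.univ.erase 0, F j = ∏ j : Fin n, F j.succ := by
  have : (Finset.univ.erase 0 : Finset (Fin (n + 1))) = Finset.univ.map (Fin.succEmb n) := by
    ext j
    refine Fin.cases ?_ (fun i => ?_) j <;> simp [Fin.succ_ne_zero]
  rw [this, Finset.prod_map]
  rfl

lemma prod_erase_succ {M : Type*} [CommMonoid M] {n : ℕ} (F : Fin (n + 1) → M) (j : Fin n) :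
    ∏ i ∈ Finset.univ.erase j.succ, F i = F 0 * ∏ i ∈ Finset.univ.erase j, F i.succ := by
  have : (Finset.univ.erase j.succ : Finset (Fin (n + 1))) =
      Finset.cons 0 ((Finset.univ.erase j).map (Fin.succEmb n)) (by simp [Fin.succ_ne_zero]) := by
    ext i
    refine Fin.cases ?_ (fun i => ?_) i <;> simp [Fin.succ_ne_zero, (Fin.succ_ne_zero _).symm]
  rw [this, Finset.prod_cons, Finset.prod_map]
  rfl

lemma det_izMat_cons (q : ℂ) {n : ℕ} (x : Fin (n + 1) → ℂ) (t : ℂ) (y : Fin n → ℂ) :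
    (izMat q x (Fin.cons t y)).det =
      ∑ k : Fin (n + 1), (-1) ^ (k : ℕ) *
        ((q - q⁻¹) / (x k - t) * ∏ j, (q * x k - q⁻¹ * y j)) *
        ((∏ i, (q * x (k.succAbove i) - q⁻¹ * t)) *
          (izMat q (fun i => x (k.succAbove i)) y).det) := by
  rw [Matrix.det_succ_row_zero]
  refine Finset.sum_congr rfl fun k _ => ?_
  congr 1
  · simp [izMat, prod_erase_zero]
  · rw [← Matrix.det_mul_row]
    congr 1
    ext j i
    simp only [izMat, Matrix.submatrix_apply, Matrix.of_apply, Fin.cons_succ, prod_erase_succ,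
      Fin.cons_zero]
    ring

lemma det_izMat_cons_self (q : ℂ) {n : ℕ} (x : Fin (n + 1) → ℂ) (y : Fin n → ℂ) (j : Fin n) :
    (izMat q x (Fin.cons (y j) y)).det = 0 := by
  refine Matrix.det_zero_of_row_eq (i := 0) (j := j.succ) (Fin.succ_ne_zero j).symm ?_
  ext i
  simp only [izMat, Matrix.of_apply, Fin.cons_zero, Fin.cons_succ, prod_erase_zero,
    prod_erase_succ]
  rw [← Finset.mul_prod_erase _ _ (Finset.mem_univ j)]

lemma prod_sub_eq_det_vandermonde {n : ℕ} (x : Fin n → ℂ) :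
    ∏ i : Fin n, ∏ j ∈ Finset.Ioi i, (x i - x j) = (Matrix.vandermonde (-x)).det := by
  rw [Matrix.det_vandermonde]
  refine Finset.prod_congr rfl fun i _ => Finset.prod_congr rfl fun j _ => ?_
  simp only [Pi.neg_apply]
  ring

lemma prod_sub_succAbove {n : ℕ} (x : Fin (n + 1) → ℂ) (k : Fin (n + 1)) :
    ∏ i : Fin (n + 1), ∏ j ∈ Finset.Ioi i, (x i - x j) =
      (-1) ^ (k : ℕ) * (∏ i, (x k - x (k.succAbove i))) *
        ∏ i : Fin n, ∏ j ∈ Finset.Ioi i, (x (k.succAbove i) - x (k.succAbove j)) := by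
  have h := Matrix.det_permute k.cycleRange.symm (Matrix.vandermonde (-x))
  have hM : (Matrix.vandermonde (-x)).submatrix k.cycleRange.symm id =
      Matrix.vandermonde (-(fun i => x (k.cycleRange.symm i))) := by
    ext i j
    simp [Matrix.vandermonde_apply]
  rw [hM, ← prod_sub_eq_det_vandermonde, ← prod_sub_eq_det_vandermonde, Equiv.Perm.sign_symm,
    Fin.sign_cycleRange, Fin.prod_univ_succ] at h
  simp only [Fin.prod_Ioi_zero, Fin.prod_Ioi_succ, Fin.cycleRange_symm_zero,
    Fin.cycleRange_symm_succ] at h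
  rw [mul_assoc, h]
  push_cast
  rw [← mul_assoc, ← mul_pow]
  simp

lemma sum_div_eq_sum_interpolation {n : ℕ} (x : Fin (n + 1) → ℂ) (y : Fin n → ℂ)
    (hx : Function.Injective x) (hy : Function.Injective y) (hxy : ∀ i j, x i ≠ y j)
    (b : Fin (n + 1) → ℂ) (G : Fin (n + 1) → Polynomial ℂ) (hG : ∀ k, (G k).natDegree ≤ n)
    (h0 : ∀ j, ∑ k, b k / (x k - y j) * (G k).eval (y j) = 0) (t : ℂ) (ht : ∀ k, x k ≠ t) :
    ∑ k, b k / (x k - t) * (G k).eval t =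
      ∑ k, b k / (x k - t) * ((G k).eval (x k) * ∏ j, (t - y j) / (x k - y j)) := by
  set Q : Fin (n + 1) → Polynomial ℂ := fun k =>
    G k - Polynomial.C ((G k).eval (x k)) *
      ∏ j, (Polynomial.C (x k - y j)⁻¹ * (Polynomial.X - Polynomial.C (y j))) with hQ
  set P : Polynomial ℂ := ∑ k, Polynomial.C (b k) *
    (Q k * ∏ i, (Polynomial.C (x (k.succAbove i)) - Polynomial.X)) with hP
  have evalQ (k : Fin (n + 1)) (s : ℂ) : (Q k).eval s =
      (G k).eval s - (G k).eval (x k) * ∏ j, (s - y j) / (x k - y j) := by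
    simp [hQ, Polynomial.eval_prod, div_eq_inv_mul]
  have evalP (s : ℂ) (hs : ∀ k, x k ≠ s) :
      P.eval s = (∏ k, (x k - s)) * ∑ k, b k / (x k - s) * (Q k).eval s := by
    simp only [hP, Polynomial.eval_finsetSum, Finset.mul_sum]
    refine Finset.sum_congr rfl fun k _ => ?_
    have := sub_ne_zero.mpr (hs k)
    rw [Fin.prod_univ_succAbove _ k]
    simp only [Polynomial.eval_mul, Polynomial.eval_C, Polynomial.eval_prod, Polynomial.eval_sub,
      Polynomial.eval_X]
    field_simp
  have hdeg : P.natDegree ≤ n + n := by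
    refine Polynomial.natDegree_sum_le_of_forall_le _ _ fun k _ => ?_
    refine (Polynomial.natDegree_C_mul_le _ _).trans (Polynomial.natDegree_mul_le_of_le ?_ ?_)
    · refine (Polynomial.natDegree_sub_le_of_le (hG k)
        ((Polynomial.natDegree_C_mul_le _ _).trans ?_)).trans (max_self n).le
      refine (Polynomial.natDegree_prod_le _ _).trans
        ((Finset.sum_le_card_nsmul _ _ 1 fun j _ => ?_).trans (by simp))
      exact (Polynomial.natDegree_C_mul_le _ _).trans (Polynomial.natDegree_X_sub_C _).le
    · refine (Polynomial.natDegree_prod_le _ _).trans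
        ((Finset.sum_le_card_nsmul _ _ 1 fun j _ => ?_).trans (by simp))
      compute_degree
  have hP0 : P = 0 := by
    refine Polynomial.eq_zero_of_natDegree_lt_card_of_eval_eq_zero P (f := Sum.elim x y)
      (hx.sumElim hy hxy) ?_ (by simp; omega)
    rintro (l | j)
    · simp only [Sum.elim_inl, hP, Polynomial.eval_finsetSum]
      refine Finset.sum_eq_zero fun k _ => ?_
      rw [Polynomial.eval_mul, Polynomial.eval_mul]
      rcases eq_or_ne l k with rfl | hlk
      · rw [evalQ, Finset.prod_eq_one fun j _ => div_self (sub_ne_zero.mpr (hxy l j))]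
        simp
      · obtain ⟨i, rfl⟩ := Fin.exists_succAbove_eq hlk
        rw [Polynomial.eval_prod, Finset.prod_eq_zero (Finset.mem_univ i) (by simp)]
        simp
    · rw [Sum.elim_inr, evalP _ fun k => hxy k j]
      convert mul_zero _
      rw [← h0 j]
      refine Finset.sum_congr rfl fun k _ => ?_
      rw [evalQ, Finset.prod_eq_zero (Finset.mem_univ j) (by simp)]
      simp
  have h := evalP t ht
  rw [hP0, Polynomial.eval_zero, eq_comm, mul_eq_zero, or_iff_right
    (Finset.prod_ne_zero_iff.mpr fun k _ => sub_ne_zero.mpr (ht k))] at h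
  rw [← sub_eq_zero, ← Finset.sum_sub_distrib, ← h]
  refine Finset.sum_congr rfl fun k _ => ?_
  rw [evalQ]
  ring

lemma Kiz_cons (q : ℂ) {n : ℕ} (x : Fin (n + 1) → ℂ) (t : ℂ) (y : Fin n → ℂ)
    (hx : Function.Injective x) (hy : Function.Injective y) (hxy : ∀ i j, x i ≠ y j)
    (hxt : ∀ i, x i ≠ t) (hyt : ∀ j, y j ≠ t) :
    Kiz q x (Fin.cons t y) = ∑ k : Fin (n + 1), gF q (x k) t * (∏ j, fF q (x k) (y j)) *
      (∏ i, fF q (x (k.succAbove i)) (x k)) * Kiz q (fun i => x (k.succAbove i)) y := by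
  set b : Fin (n + 1) → ℂ := fun k => (-1) ^ (k : ℕ) * (q - q⁻¹) *
    (∏ j, (q * x k - q⁻¹ * y j)) * (izMat q (fun i => x (k.succAbove i)) y).det with hb
  set G : Fin (n + 1) → Polynomial ℂ := fun k =>
    ∏ i, (Polynomial.C (q * x (k.succAbove i)) - Polynomial.C q⁻¹ * Polynomial.X) with hG
  have evalG (k : Fin (n + 1)) (s : ℂ) :
      (G k).eval s = ∏ i, (q * x (k.succAbove i) - q⁻¹ * s) := by
    simp [hG, Polynomial.eval_prod]
  have hdet (s : ℂ) : (izMat q x (Fin.cons s y)).det =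
      ∑ k, b k / (x k - s) * (G k).eval s := by
    rw [det_izMat_cons]
    refine Finset.sum_congr rfl fun k _ => ?_
    rw [evalG]
    simp only [hb]
    ring
  have key := sum_div_eq_sum_interpolation x y hx hy hxy b G
    (fun k => (Polynomial.natDegree_prod_le _ _).trans
      ((Finset.sum_le_card_nsmul _ _ 1 fun j _ => by compute_degree).trans (by simp)))
    (fun j => by rw [← hdet, det_izMat_cons_self]) t hxt
  have hVx : ∏ i : Fin (n + 1), ∏ j ∈ Finset.Ioi i, (x i - x j) ≠ 0 := by
    refine Finset.prod_ne_zero_iff.mpr fun i _ => Finset.prod_ne_zero_iff.mpr fun j hj => ?_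
    exact sub_ne_zero.mpr (hx.ne (Finset.mem_Ioi.mp hj).ne)
  have hyt' : ∏ j, (t - y j) ≠ 0 :=
    Finset.prod_ne_zero_iff.mpr fun j _ => sub_ne_zero.mpr (hyt j).symm
  rw [Kiz_eq_det, hdet, key, Finset.mul_sum]
  refine Finset.sum_congr rfl fun k _ => ?_
  have hxk : ∏ i, (x k - x (k.succAbove i)) ≠ 0 :=
    Finset.prod_ne_zero_iff.mpr fun i _ => sub_ne_zero.mpr (hx.ne (Fin.succAbove_ne k i).symm)
  have hxyk : ∏ j, (x k - y j) ≠ 0 :=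
    Finset.prod_ne_zero_iff.mpr fun j _ => sub_ne_zero.mpr (hxy k j)
  have hneg (F : Fin n → ℂ) (s : ℂ) : ∏ i, (F i - s) = (-1) ^ n * ∏ i, (s - F i) := by
    rw [← Fin.prod_const, ← Finset.prod_mul_distrib]
    exact Finset.prod_congr rfl fun i _ => by ring
  rw [Kiz_eq_det]
  simp only [Finset.prod_mul_distrib, fF, gF, Finset.prod_div_distrib, evalG]
  rw [prod_sub_succAbove x k] at hVx ⊢
  have hVk := right_ne_zero_of_mul hVx
  rw [Fin.prod_univ_succ (fun i : Fin (n + 1) => ∏ j ∈ Finset.Ioi i,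
    ((Fin.cons t y : Fin (n + 1) → ℂ) j - (Fin.cons t y : Fin (n + 1) → ℂ) i))]
  simp only [Fin.prod_Ioi_zero, Fin.prod_Ioi_succ, Fin.cons_zero, Fin.cons_succ]
  rw [hneg y t, hneg (fun i => x (k.succAbove i)) (x k)]
  have := sub_ne_zero.mpr (hxt k)
  have hVy : ∏ i : Fin n, ∏ j ∈ Finset.Ioi i, (y j - y i) ≠ 0 := by
    refine Finset.prod_ne_zero_iff.mpr fun i _ => Finset.prod_ne_zero_iff.mpr fun j hj => ?_
    exact sub_ne_zero.mpr (hy.ne (Finset.mem_Ioi.mp hj).ne')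
  simp only [hb]
  field_simp

lemma prod_sub_swap_sq {n : ℕ} (q : ℂ) (x y : Fin n → ℂ) :
    ∏ i : Fin n, ∏ j ∈ Finset.Ioi i, ((y i - y j) * (q ^ 2 * x j - q ^ 2 * x i)) =
      q ^ (n * (n - 1)) * ∏ i : Fin n, ∏ j ∈ Finset.Ioi i, ((x i - x j) * (y j - y i)) := by
  have h : (q : ℂ) ^ (n * (n - 1)) = ∏ i : Fin n, ∏ _j ∈ Finset.Ioi i, q ^ 2 := by
    simp only [Finset.prod_const, Fin.card_Ioi, Finset.prod_pow_eq_pow_sum, ← pow_mul]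
    rw [← Finset.mul_sum, Fin.sum_univ_eq_sum_range (fun i => n - 1 - i) n,
      Finset.sum_range_reflect (fun i => i) n, mul_comm 2, Finset.sum_range_id_mul_two]
  rw [h]
  simp only [← Finset.prod_mul_distrib]
  refine Finset.prod_congr rfl fun i _ => Finset.prod_congr rfl fun j _ => ?_
  ring

lemma Kiz_swap (q : ℂ) (hq : q ≠ 0) {n : ℕ} (x y : Fin n → ℂ) (hxy : ∀ i j, x i ≠ y j)
    (hxy2 : ∀ i j, q ^ 2 * x i ≠ y j) :
    Kiz q x y = (-q) ^ n * (∏ i, ∏ j, fF q (x i) (y j)) * Kiz q y (fun i => q ^ 2 * x i) := by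
  have hM : (izMat q x y).det = q ^ (2 * n) *
      ((∏ i, ∏ j, (q * x i - q⁻¹ * y j)) * (∏ j, ∏ i, (q * y j - q * x i))⁻¹ *
        (izMat q y (fun i => q ^ 2 * x i)).det) := by
    rw [← Matrix.det_transpose (izMat q y _), mul_assoc, ← Finset.prod_inv_distrib,
      ← Matrix.det_mul_column, ← Matrix.det_mul_row, mul_comm 2 n, pow_mul', ← Fin.prod_const,
      ← Matrix.det_mul_row]
    congr 1
    ext j i
    have h1 := sub_ne_zero.mpr (hxy i j)
    have h4 (i' : Fin n) : q⁻¹ * (q ^ 2 * x i') = q * x i' := by field_simp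
    simp only [izMat, Matrix.of_apply, Matrix.transpose_apply, h4]
    rw [← Finset.mul_prod_erase Finset.univ (fun j => q * x i - q⁻¹ * y j) (Finset.mem_univ j),
      ← Finset.mul_prod_erase Finset.univ (fun i => q * y j - q * x i) (Finset.mem_univ i)]
    have h3 : ∏ i' ∈ Finset.univ.erase i, (q * y j - q * x i') ≠ 0 := by
      refine Finset.prod_ne_zero_iff.mpr fun i' _ => ?_
      rw [← mul_sub]
      exact mul_ne_zero hq (sub_ne_zero.mpr (hxy i' j).symm)
    have h2 : y j - q ^ 2 * x i ≠ 0 := sub_ne_zero.mpr (hxy2 i j).symm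
    generalize ∏ i' ∈ Finset.univ.erase i, (q * y j - q * x i') = E at h3 ⊢
    generalize ∏ j' ∈ Finset.univ.erase j, (q * x i - q⁻¹ * y j') = F
    have h5 : y j - x i ≠ 0 := sub_ne_zero.mpr (hxy i j).symm
    field_simp
    ring
  have hB : ∏ j, ∏ i, (q * y j - q * x i) = (-q) ^ (n * n) * ∏ i, ∏ j, (x i - y j) := by
    rw [Finset.prod_comm, pow_mul, ← Fin.prod_const, ← Finset.prod_mul_distrib]
    refine Finset.prod_congr rfl fun i _ => ?_
    rw [← Fin.prod_const, ← Finset.prod_mul_distrib]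
    exact Finset.prod_congr rfl fun j _ => by ring
  have hp : (-q) ^ n * (-q) ^ (n * n) = q ^ (2 * n) * q ^ (n * (n - 1)) := by
    rw [← pow_add, ← pow_add, show n + n * n = n * (n + 1) by ring,
      (Nat.even_mul_succ_self n).neg_pow]
    congr 1
    cases n with
    | zero => rfl
    | succ m => simp only [Nat.add_sub_cancel]; ring
  have h1 : (-q) ^ (n * n) ≠ 0 := pow_ne_zero _ (neg_ne_zero.mpr hq)
  have h2 : q ^ (n * (n - 1)) ≠ 0 := pow_ne_zero _ hq
  have hc : q ^ (2 * n) * ((-q) ^ (n * n))⁻¹ = (-q) ^ n * (q ^ (n * (n - 1)))⁻¹ := by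
    rw [← div_eq_mul_inv, ← div_eq_mul_inv, div_eq_div_iff h1 h2, hp]
  rw [Kiz_eq_det, Kiz_eq_det, hM, hB, prod_sub_swap_sq]
  simp only [fF, Finset.prod_div_distrib]
  rw [div_eq_mul_inv, mul_inv, mul_inv]
  linear_combination (∏ i : Fin n, ∏ j ∈ Finset.Ioi i, ((x i - x j) * (y j - y i)))⁻¹ *
    (∏ i, ∏ j, (q * x i - q⁻¹ * y j)) * (∏ i, ∏ j, (x i - y j))⁻¹ *
    (izMat q y (fun i => q ^ 2 * x i)).det * hc

/-- The recursive form of the Izergin determinant `K(γ_S | l)`, obtained by expanding in the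
poles of the first entry of `l`. -/
noncomputable def izRec (q : ℂ) {ι : Type*} [DecidableEq ι] (γ : ι → ℂ) :
    List ℂ → Finset ι → ℂ
  | [], _ => 1
  | y :: l, S => ∑ k ∈ S, gF q (γ k) y * (l.map fun z => fF q (γ k) z).prod *
      (∏ i ∈ S.erase k, fF q (γ i) (γ k)) * izRec q γ l (S.erase k)

lemma sub_injective {N m : ℕ} (γ : Fin N → ℂ) (hγ : Function.Injective γ)
    (I : Finset (Fin N)) (h : I.card = m) : Function.Injective (sub γ I h) :=
  hγ.comp (Subtype.val_injective.comp (I.orderIsoOfFin h).injective)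

lemma prod_sub_apply {M : Type*} [CommMonoid M] {N m : ℕ} (γ : Fin N → ℂ)
    (I : Finset (Fin N)) (h : I.card = m) (F : ℂ → M) :
    ∏ k, F (sub γ I h k) = ∏ k ∈ I, F (γ k) := by
  rw [← Finset.prod_coe_sort I fun k => F (γ k)]
  exact Fintype.prod_equiv (I.orderIsoOfFin h).toEquiv _ _ fun _ => rfl

lemma sub_succAbove {N m : ℕ} (γ : Fin N → ℂ) (I : Finset (Fin N)) (h : I.card = m + 1)
    (k : Fin (m + 1)) (h' : (I.erase (I.orderIsoOfFin h k : Fin N)).card = m) :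
    (fun i => sub γ I h (k.succAbove i)) = sub γ (I.erase (I.orderIsoOfFin h k : Fin N)) h' := by
  have := Finset.orderEmbOfFin_unique h' (f := fun i => (I.orderIsoOfFin h (k.succAbove i) : Fin N))
    (fun i => Finset.mem_erase.mpr ⟨fun e => Fin.succAbove_ne k i
      ((I.orderIsoOfFin h).injective (Subtype.ext e)), (I.orderIsoOfFin h _).2⟩)
    (fun i j hij => (I.orderIsoOfFin h).strictMono (Fin.strictMono_succAbove k hij))
  ext i
  exact congrArg γ (congrFun this i)

lemma Kiz_sub_eq_izRec (q : ℂ) {N : ℕ} (γ : Fin N → ℂ) (hγ : Function.Injective γ) {m : ℕ}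
    (y : Fin m → ℂ) (hy : Function.Injective y) (hγy : ∀ k j, γ k ≠ y j)
    (I : Finset (Fin N)) (h : I.card = m) :
    Kiz q (sub γ I h) y = izRec q γ (List.ofFn y) I := by
  induction m generalizing I with
  | zero => simp [Kiz, izRec]
  | succ m ih =>
    have hcard (k : Fin (m + 1)) : (I.erase (I.orderIsoOfFin h k : Fin N)).card = m := by
      rw [Finset.card_erase_of_mem (I.orderIsoOfFin h k).2, h, Nat.add_sub_cancel]
    conv_lhs => rw [← Fin.cons_self_tail y]
    rw [Kiz_cons q _ _ (Fin.tail y) (sub_injective γ hγ I h) (hy.comp (Fin.succ_injective m))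
      (fun _ _ => hγy _ _) (fun _ => hγy _ _) (fun j => hy.ne (Fin.succ_ne_zero j)),
      List.ofFn_succ, izRec]
    refine Eq.trans ?_ (Finset.sum_coe_sort I _)
    refine Fintype.sum_equiv (I.orderIsoOfFin h).toEquiv _ _ fun k => ?_
    have hF := prod_sub_apply γ _ (hcard k) fun z => fF q z (sub γ I h k)
    rw [← sub_succAbove γ I h k (hcard k)] at hF
    rw [hF, sub_succAbove γ I h k (hcard k),
      ih (Fin.tail y) (hy.comp (Fin.succ_injective m)) (fun _ _ => hγy _ _) _ (hcard k),
      List.map_ofFn, List.prod_ofFn]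
    rfl

lemma sum_powersetCard_succ_sum {ι M : Type*} [DecidableEq ι] [AddCommMonoid M] (S : Finset ι)
    (n : ℕ) (F : Finset ι → ι → M) :
    ∑ I ∈ Finset.powersetCard (n + 1) S, ∑ k ∈ I, F I k =
      ∑ k ∈ S, ∑ J ∈ Finset.powersetCard n (S.erase k), F (insert k J) k := by
  rw [Finset.sum_sigma', Finset.sum_sigma']
  refine Finset.sum_bij' (fun p _ => ⟨p.2, p.1.erase p.2⟩) (fun p _ => ⟨insert p.1 p.2, p.1⟩)
    ?_ ?_ ?_ ?_ ?_
  · rintro ⟨I, k⟩ h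
    simp only [Finset.mem_sigma, Finset.mem_powersetCard] at h ⊢
    refine ⟨h.1.1 h.2, Finset.erase_subset_erase k h.1.1, ?_⟩
    rw [Finset.card_erase_of_mem h.2, h.1.2, Nat.add_sub_cancel]
  · rintro ⟨k, J⟩ h
    simp only [Finset.mem_sigma, Finset.mem_powersetCard] at h ⊢
    have hk : k ∉ J := fun hk => Finset.notMem_erase k S (h.2.1 hk)
    refine ⟨⟨Finset.insert_subset h.1 (h.2.1.trans (Finset.erase_subset k S)), ?_⟩,
      Finset.mem_insert_self k J⟩
    rw [Finset.card_insert_of_notMem hk, h.2.2]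
  · rintro ⟨I, k⟩ h
    simp only [Finset.mem_sigma] at h
    simp [Finset.insert_erase h.2]
  · rintro ⟨k, J⟩ h
    simp only [Finset.mem_sigma, Finset.mem_powersetCard] at h
    have hk : k ∉ J := fun hk => Finset.notMem_erase k S (h.2.1 hk)
    simp [Finset.erase_insert hk]
  · rintro ⟨I, k⟩ h
    simp only [Finset.mem_sigma] at h
    simp [Finset.insert_erase h.2]

/-- The summation formula for `izRec`, with the weight `Φ` of the complementary subset
proportional to `izRec q γ b` through factors `w k` inverse to `∏_{z ∈ b} f(γ k, z)`. -/
lemma sum_izRec_mul (q : ℂ) {ι : Type*} [DecidableEq ι] (γ : ι → ℂ) (b : List ℂ)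
    (Φ : Finset ι → ℂ) (C : ℂ) (w : ι → ℂ)
    (hw : ∀ k, w k * (b.map fun z => fF q (γ k) z).prod = 1)
    (hΦ : ∀ T : Finset ι, T.card = b.length → Φ T = C * (∏ k ∈ T, w k) * izRec q γ b T)
    (a : List ℂ) (S : Finset ι) (hS : S.card = a.length + b.length) :
    ∑ I ∈ Finset.powersetCard a.length S,
        izRec q γ a I * Φ (S \ I) * ∏ k ∈ S \ I, ∏ l ∈ I, fF q (γ k) (γ l) =
      C * (∏ k ∈ S, w k) * izRec q γ (a ++ b) S := by
  induction a generalizing S with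
  | nil => simpa [izRec] using hΦ S (by simpa using hS)
  | cons y a ih =>
    simp only [List.length_cons, izRec, Finset.sum_mul, List.cons_append]
    rw [sum_powersetCard_succ_sum S a.length fun I k =>
      gF q (γ k) y * (a.map fun z => fF q (γ k) z).prod *
      (∏ i ∈ I.erase k, fF q (γ i) (γ k)) * izRec q γ a (I.erase k) * Φ (S \ I) *
      ∏ k ∈ S \ I, ∏ l ∈ I, fF q (γ k) (γ l), Finset.mul_sum]
    refine Finset.sum_congr rfl fun k hk => ?_
    have hcard : (S.erase k).card = a.length + b.length := by
      rw [Finset.card_erase_of_mem hk, hS, List.length_cons]; omega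
    have hterm : ∀ J ∈ Finset.powersetCard a.length (S.erase k),
        gF q (γ k) y * (a.map fun z => fF q (γ k) z).prod *
          (∏ i ∈ (insert k J).erase k, fF q (γ i) (γ k)) * izRec q γ a ((insert k J).erase k) *
          Φ (S \ insert k J) * ∏ i ∈ S \ insert k J, ∏ l ∈ insert k J, fF q (γ i) (γ l) =
        gF q (γ k) y * (a.map fun z => fF q (γ k) z).prod *
          (∏ i ∈ S.erase k, fF q (γ i) (γ k)) *
          (izRec q γ a J * Φ (S.erase k \ J) *
            ∏ i ∈ S.erase k \ J, ∏ l ∈ J, fF q (γ i) (γ l)) := by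
      intro J hJ
      have hJS := (Finset.mem_powersetCard.mp hJ).1
      have hkJ : k ∉ J := fun h => Finset.notMem_erase k S (hJS h)
      have hdiff : S \ insert k J = S.erase k \ J := by
        ext i
        simp only [Finset.mem_sdiff, Finset.mem_insert, Finset.mem_erase]
        tauto
      rw [hdiff, Finset.erase_insert hkJ, ← Finset.prod_sdiff hJS]
      simp only [Finset.prod_insert hkJ, Finset.prod_mul_distrib]
      ring
    rw [Finset.sum_congr rfl hterm, ← Finset.mul_sum, ih _ hcard, ← Finset.mul_prod_erase S w hk,
      List.map_append, List.prod_append]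
    linear_combination (-gF q (γ k) y * (a.map fun z => fF q (γ k) z).prod *
      (∏ i ∈ S.erase k, fF q (γ i) (γ k)) * C * (∏ i ∈ S.erase k, w i) *
      izRec q γ (a ++ b) (S.erase k)) * hw k

/-- Summation formula for the Izergin determinant (main lemma, second form). -/
theorem izergin_summation_second (q : ℂ) (hq : q ≠ 0) (hq2 : q ^ 2 ≠ 1)
    (m₁ m₂ : ℕ) (α : Fin m₁ → ℂ) (β : Fin m₂ → ℂ) (γ : Fin (m₁ + m₂) → ℂ)
    (hα : Function.Injective α) (hβ : Function.Injective β) (hγ : Function.Injective γ)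
    (hαγ : ∀ i k, α i ≠ γ k) (hβγ : ∀ j k, β j ≠ γ k)
    (hαβ : ∀ i j, α i ≠ q ^ 2 * β j)
    (hβγ2 : ∀ j k, q ^ 2 * β j ≠ γ k) :
    ∑ I ∈ (Finset.powersetCard m₁ (Finset.univ : Finset (Fin (m₁ + m₂)))).attach,
        Kiz q (sub γ I.1 (Finset.mem_powersetCard.mp I.2).2) α *
          Kiz q β (sub γ I.1ᶜ (card_compl_of_mem_powersetCard I)) *
          ∏ k ∈ I.1ᶜ, ∏ l ∈ I.1, fF q (γ k) (γ l)
      = (-q) ^ m₂ * (∏ j, ∏ k, fF q (β j) (γ k)) *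
          Kiz q γ (Fin.append α (fun j => q ^ 2 * β j)) := by
  have hinj : Function.Injective fun j => q ^ 2 * β j :=
    (mul_right_injective₀ (pow_ne_zero 2 hq)).comp hβ
  have hfull (T : Finset (Fin (m₁ + m₂))) (hT : T.card = m₂) :
      Kiz q β (sub γ T hT) = (-q) ^ m₂ * (∏ k ∈ T, ∏ j, fF q (β j) (γ k)) *
        izRec q γ (List.ofFn fun j => q ^ 2 * β j) T := by
    rw [Kiz_swap q hq β (sub γ T hT) (fun _ _ => hβγ _ _) (fun _ _ => hβγ2 _ _),
      Kiz_sub_eq_izRec q γ hγ _ hinj (fun k j => (hβγ2 j k).symm), Finset.prod_comm,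
      prod_sub_apply γ T hT fun z => ∏ j, fF q (β j) z]
  have hw (k : Fin (m₁ + m₂)) : (∏ j, fF q (β j) (γ k)) *
      ((List.ofFn fun j => q ^ 2 * β j).map fun z => fF q (γ k) z).prod = 1 := by
    rw [List.map_ofFn, List.prod_ofFn, ← Finset.prod_mul_distrib]
    refine Finset.prod_eq_one fun j _ => ?_
    have h1 := sub_ne_zero.mpr (hβγ j k)
    have h2 := sub_ne_zero.mpr (hβγ2 j k).symm
    simp only [fF, Function.comp_apply]
    field_simp
    ring
  have hsum := sum_izRec_mul q γ (List.ofFn fun j => q ^ 2 * β j)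
    (fun T => (-q) ^ m₂ * (∏ k ∈ T, ∏ j, fF q (β j) (γ k)) *
      izRec q γ (List.ofFn fun j => q ^ 2 * β j) T) ((-q) ^ m₂) _ hw (fun _ _ => rfl)
    (List.ofFn α) Finset.univ (by simp)
  have hγuniv : sub γ Finset.univ (Finset.card_fin (m₁ + m₂)) = γ := by
    have := Finset.orderEmbOfFin_unique (Finset.card_fin (m₁ + m₂)) (f := id)
      (fun _ => Finset.mem_univ _) strictMono_id
    ext k
    exact congrArg γ (congrFun this k).symm
  have happ : Function.Injective (Fin.append α fun j => q ^ 2 * β j) :=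
    Fin.append_injective_iff.mpr ⟨hα, hinj, hαβ⟩
  have hγapp (k) (j) : γ k ≠ Fin.append α (fun j => q ^ 2 * β j) j := by
    refine Fin.addCases (fun i => ?_) (fun i => ?_) j
    · simpa using (hαγ i k).symm
    · simpa using (hβγ2 i k).symm
  have hR := Kiz_sub_eq_izRec q γ hγ _ happ hγapp Finset.univ (Finset.card_fin _)
  rw [hγuniv, List.ofFn_fin_append] at hR
  rw [hR, Finset.prod_comm, ← hsum, List.length_ofFn,
    ← Finset.sum_attach (Finset.powersetCard m₁ Finset.univ)]
  refine Finset.sum_congr rfl fun I _ => ?_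
  rw [Kiz_sub_eq_izRec q γ hγ α hα (fun k j => (hαγ j k).symm), hfull,
    Finset.compl_eq_univ_sdiff]
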